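/- arXiv:2205.05434 — 4 statements merged into one kernel-verified Lean document; each statement's English description precedes it below -/
import Mathlib

section
/- Let S be a semigroup and k ≥ 1 an integer with S^k = S^{k+1}. Suppose that for some integer n ≥ k the semigroup S satisfies the identities (2) and the identity (3) for parameter n. Then the subsemigroup S^k satisfies the identities (1): for all a, y, z ∈ S^k one has a² = a³, aya = ayaya, and ayaza = azaya. -/
universe u

/-- Product of a list of semigroup elements, computed in `WithOne S`
(the empty list gives `1`). -/
def listSProd {S : Type u} [Semigroup S] (l : List S) : WithOne S :=
  (l.map (fun a => (a : WithOne S))).prod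

/-- `SPow S m` : the set of elements of `S` that are products of `m` or more
elements of `S`. -/
def SPow (S : Type u) [Semigroup S] (m : ℕ) : Set S :=
  {x | ∃ l : List S, m ≤ l.length ∧ listSProd l = (x : WithOne S)}

/-- `SES S` : the set of elements of the form `x * e * y` with `e` idempotent. -/
def SES (S : Type u) [Semigroup S] : Set S :=
  {s | ∃ x e y : S, e * e = e ∧ s = x * e * y}

/-- positive powers in a semigroup: `ppow a k = a ^ (k+1)`. -/
def ppow {S : Type u} [Semigroup S] (a : S) : ℕ → S
  | 0 => a
  | k + 1 => ppow a k * a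

/-- `u` and `v` have the same set of factors (contiguous subwords) of length `k`. -/
def SameFactors {α : Type u} (k : ℕ) (u v : List α) : Prop :=
  ∀ x : List α, x.length = k →
    ((∃ p q : List α, u = p ++ x ++ q) ↔ (∃ p q : List α, v = p ++ x ++ q))

/-- `φ` identifies any two nonempty words with the same prefix of length `ps`,
the same suffix of length `ps` and the same set of factors of length `k`. -/
def TestableFor {α S : Type u} [Semigroup S] (ps k : ℕ) (φ : List α → S) : Prop :=
  ∀ u v : List α, u ≠ [] → v ≠ [] →
    u.take ps = v.take ps →
    u.drop (u.length - ps) = v.drop (v.length - ps) →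
    SameFactors k u v →
    φ u = φ v

/-- `φ : List α → S` is a semigroup homomorphism from the free semigroup of
nonempty words over `α` to `S`. -/
def IsSgHom {α S : Type u} [Semigroup S] (φ : List α → S) : Prop :=
  ∀ u v : List α, u ≠ [] → v ≠ [] → φ (u ++ v) = φ u * φ v

/-- `φ` is surjective on nonempty words. -/
def SurjOnWords {α S : Type u} (φ : List α → S) : Prop :=
  ∀ s : S, ∃ u : List α, u ≠ [] ∧ φ u = s

/-- `S` is `k`-testable. -/
def IsKTestable (S : Type u) [Semigroup S] (k : ℕ) : Prop :=
  ∃ (α : Type u) (φ : List α → S), IsSgHom φ ∧ SurjOnWords φ ∧ TestableFor k k φ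

/-- `S` is `k`-testable in the sense of Brzozowski–Simon. -/
def IsKTestableBS (S : Type u) [Semigroup S] (k : ℕ) : Prop :=
  ∃ (α : Type u) (φ : List α → S), IsSgHom φ ∧ SurjOnWords φ ∧ TestableFor (k - 1) k φ

/-- `S` is locally testable. -/
def LocallyTestable (S : Type u) [Semigroup S] : Prop :=
  ∃ k : ℕ, 1 ≤ k ∧ IsKTestable S k

/-- The identities (2) for parameter `n`. -/
def Ident2 (S : Type u) [Semigroup S] (n : ℕ) : Prop :=
  ∀ r : ℕ, 1 ≤ r → r ≤ n → ∀ x : Fin r → S,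
    listSProd (List.ofFn x) ^ ((n - (n - 1) % r - 1) / r + 1)
        * listSProd ((List.ofFn x).take ((n - 1) % r))
      = listSProd (List.ofFn x) ^ ((n - (n - 1) % r - 1) / r + 2)
        * listSProd ((List.ofFn x).take ((n - 1) % r))

/-- The identity (3) for parameter `n`. -/
def Ident3 (S : Type u) [Semigroup S] (n : ℕ) : Prop :=
  ∀ (t₁ t₂ y z : S) (x : Fin (n - 1) → S),
    (t₁ : WithOne S) * listSProd (List.ofFn x) * y * listSProd (List.ofFn x) * z
        * listSProd (List.ofFn x) * t₂
      = (t₁ : WithOne S) * listSProd (List.ofFn x) * z * listSProd (List.ofFn x) * y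
        * listSProd (List.ofFn x) * t₂

/-- The identity (4) for parameter `n`. -/
def Ident4 (S : Type u) [Semigroup S] (n : ℕ) : Prop :=
  ∀ (y z : S) (x : Fin (n - 1) → S),
    listSProd (List.ofFn x) * y * listSProd (List.ofFn x) * z * listSProd (List.ofFn x)
      = listSProd (List.ofFn x) * z * listSProd (List.ofFn x) * y * listSProd (List.ofFn x)

theorem listSProd_cons {S : Type u} [Semigroup S] (s : S) (l : List S) :
    listSProd (s :: l) = (s : WithOne S) * listSProd l := by
  simp [listSProd]

theorem listSProd_append {S : Type u} [Semigroup S] (l m : List S) :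
    listSProd (l ++ m) = listSProd l * listSProd m := by
  simp [listSProd]

theorem listSProd_singleton {S : Type u} [Semigroup S] (s : S) :
    listSProd [s] = (s : WithOne S) := by
  simp [listSProd]

theorem exists_coe_eq_listSProd {S : Type u} [Semigroup S] {l : List S} (hl : l ≠ []) :
    ∃ s : S, listSProd l = (s : WithOne S) := by
  induction l with
  | nil => exact absurd rfl hl
  | cons s l ih =>
    rcases eq_or_ne l [] with rfl | h
    · exact ⟨s, listSProd_singleton s⟩
    · obtain ⟨t, ht⟩ := ih h
      exact ⟨s * t, by rw [listSProd_cons, ht, WithOne.coe_mul]⟩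

theorem exists_eq_mul_of_mem_SPow_succ {S : Type u} [Semigroup S] {k : ℕ} (hk : 1 ≤ k)
    {a : S} (ha : a ∈ SPow S (k + 1)) : ∃ s : S, ∃ b ∈ SPow S k, a = s * b := by
  obtain ⟨l, hl, hla⟩ := ha
  cases l with
  | nil => simp at hl
  | cons s l =>
    have hl' : k ≤ l.length := by simpa using hl
    have hne : l ≠ [] := List.ne_nil_of_length_pos (by lia)
    obtain ⟨b, hb⟩ := exists_coe_eq_listSProd hne
    refine ⟨s, b, ⟨l, hl', hb⟩, ?_⟩
    rw [listSProd_cons, hb] at hla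
    exact_mod_cast hla.symm

theorem exists_eq_listSProd_mul_of_mem_SPow {S : Type u} [Semigroup S] {k : ℕ} (hk : 1 ≤ k)
    (hSk : SPow S k = SPow S (k + 1)) (N : ℕ) {a : S} (ha : a ∈ SPow S k) :
    ∃ (l : List S) (c : S), l.length = N ∧ (a : WithOne S) = listSProd l * c := by
  induction N generalizing a with
  | zero => exact ⟨[], a, rfl, by simp [listSProd]⟩
  | succ N ih =>
    obtain ⟨s, b, hb, rfl⟩ := exists_eq_mul_of_mem_SPow_succ hk (hSk ▸ ha)
    obtain ⟨l, c, hl, hc⟩ := ih hb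
    exact ⟨s :: l, c, by simp [hl], by rw [listSProd_cons, WithOne.coe_mul, hc, mul_assoc]⟩

/-- The case `r = n` of the identities (2). -/
theorem Ident2.listSProd_mul {S : Type u} [Semigroup S] {n : ℕ} (h : Ident2 S n) {l : List S}
    (hl : l.length + 1 = n) (s : S) :
    listSProd l * s * listSProd l = listSProd l * s * (listSProd l * s) * listSProd l := by
  have hlen : (l ++ [s]).length = n := by simpa using hl
  subst hlen
  have key := h _ (by simp) le_rfl (l ++ [s]).get
  have hmod : ((l ++ [s]).length - 1) % (l ++ [s]).length = l.length := by
    rw [Nat.mod_eq_of_lt] <;> simp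
  have hdiv : ((l ++ [s]).length - l.length - 1) / (l ++ [s]).length = 0 := by simp
  rw [List.ofFn_get, hmod, hdiv, List.take_left' rfl, listSProd_append,
    listSProd_singleton] at key
  simpa [pow_succ] using key

theorem Ident3.listSProd_mul {S : Type u} [Semigroup S] {n : ℕ} (h : Ident3 S n) {l : List S}
    (hl : l.length = n - 1) (t₁ t₂ y z : S) :
    (t₁ : WithOne S) * listSProd l * y * listSProd l * z * listSProd l * t₂
      = (t₁ : WithOne S) * listSProd l * z * listSProd l * y * listSProd l * t₂ := by
  unfold Ident3 at h
  rw [← hl] at h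
  simpa only [List.ofFn_get] using h t₁ t₂ y z l.get

/-- Lemma 1, first part: if `S^k = S^{k+1}` and `S` satisfies the
identities (2) and (3) for some parameter `n ≥ k`, then `S^k` satisfies the
identities (1). -/
theorem stmt0 {S : Type u} [Semigroup S] (k n : ℕ) (hk : 1 ≤ k)
    (hSk : SPow S k = SPow S (k + 1)) (hkn : k ≤ n)
    (h2 : Ident2 S n) (h3 : Ident3 S n) :
    ∀ a ∈ SPow S k, ∀ y ∈ SPow S k, ∀ z ∈ SPow S k,
      a * a = a * a * a ∧
      a * y * a = a * y * a * y * a ∧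
      a * y * a * z * a = a * z * a * y * a := by
  intro a ha y _ z _
  obtain ⟨l, c, hl, hac⟩ := exists_eq_listSProd_mul_of_mem_SPow hk hSk (n - 1) ha
  have hl' : l.length + 1 = n := by lia
  refine ⟨?_, ?_, ?_⟩
  · have h := congrArg (· * (c : WithOne S)) (h2.listSProd_mul hl' c)
    apply WithOne.coe_injective
    simpa only [WithOne.coe_mul, hac, mul_assoc] using h
  · have h := congrArg (· * (c : WithOne S)) (h2.listSProd_mul hl' (c * y))
    apply WithOne.coe_injective
    simpa only [WithOne.coe_mul, hac, mul_assoc] using h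
  · obtain ⟨t, b, hb, rfl⟩ := exists_eq_mul_of_mem_SPow_succ hk (hSk ▸ ha)
    obtain ⟨m, d, hm, hbd⟩ := exists_eq_listSProd_mul_of_mem_SPow hk hSk (n - 1) hb
    have h := h3.listSProd_mul hm t d (d * y * t) (d * z * t)
    apply WithOne.coe_injective
    simpa only [WithOne.coe_mul, hbd, mul_assoc] using h
end

section
/- Let S be a semigroup satisfying x² = x³ and xyx = xyxyx for all x, y ∈ S. Let i, j, e ∈ S be idempotents such that e is a common unit of i and j, i.e. ei = i = ie and ej = j = je. If iji = jij, then ij = ji. -/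
universe u

/-- from the proof of Lemma 3: in a semigroup satisfying
`x² = x³` and `xyx = xyxyx`, if the idempotents `i`, `j` have the idempotent
`e` as a common unit and `iji = jij`, then `ij = ji`. -/
theorem stmt13 {S : Type u} [Semigroup S]
    (hxx : ∀ x : S, x * x = x * x * x)
    (hxyx : ∀ x y : S, x * y * x = x * y * x * y * x)
    (i j e : S) (hi : i * i = i) (hj : j * j = j) (he : e * e = e)
    (hei : e * i = i) (hie : i * e = i) (hej : e * j = j) (hje : j * e = j)
    (h : i * j * i = j * i * j) : i * j = j * i := by
  have idem : ∀ y : S, e * y = y → y * e = y → y = y * y := fun y hl hr => by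
    have := hxyx e y
    rwa [hl, hr, mul_assoc, hr] at this
  have hij : i * j = i * j * (i * j) :=
    idem _ (by rw [← mul_assoc, hei]) (by rw [mul_assoc, hje])
  have hji : j * i = j * i * (j * i) :=
    idem _ (by rw [← mul_assoc, hej]) (by rw [mul_assoc, hie])
  calc i * j = i * j * i * j := by rw [mul_assoc (i * j), ← hij]
    _ = j * i * j := by rw [h, mul_assoc, hj]
    _ = j * i * j * i := by rw [← h, mul_assoc (i * j), hi]
    _ = j * i := by rw [mul_assoc (j * i), ← hji]
end

section
/- Let S be a semigroup and n ≥ 2 an integer such that uyu = uyuyu for all u ∈ S^{n−1} and all y ∈ S. Let a ∈ S^{n−1} and b, c ∈ S, and suppose that abacab ≠ acabacab. Then e := abacab and i := acabacab are two distinct idempotents of S satisfying ei = e and ie = i; in particular e and i are distinct idempotents with the common left divisor a in S^{n−1} (e = a·(bacab) and i = a·(cabacab)). -/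
universe u

/-- If `BBC = BC` and `BCBCB = BCB`, then `BCB` and `CBCB` are idempotents which generate a
left-zero semigroup. -/
theorem idempotent_pair_of_mul_eq {S : Type*} [Semigroup S] {B C : S}
    (h₁ : B * (B * C) = B * C) (h₂ : B * (C * (B * (C * B))) = B * (C * B)) :
    (B * (C * B)) * (B * (C * B)) = B * (C * B) ∧
    (C * (B * (C * B))) * (C * (B * (C * B))) = C * (B * (C * B)) ∧
    (B * (C * B)) * (C * (B * (C * B))) = B * (C * B) ∧
    (C * (B * (C * B))) * (B * (C * B)) = C * (B * (C * B)) := by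
  have h₁' : ∀ z, B * (B * (C * z)) = B * (C * z) := fun z => by
    simpa only [mul_assoc] using congrArg (· * z) h₁
  refine ⟨?_, ?_, ?_, ?_⟩ <;> simp only [mul_assoc, h₁', h₂]

/-- from the proof of Lemma 4: if `uyu = uyuyu` for all
`u ∈ S^{n-1}`, `y ∈ S`, and `a ∈ S^{n-1}`, `b, c ∈ S` with
`abacab ≠ acabacab`, then `e = abacab` and `i = acabacab` are distinct
idempotents with `ei = e`, `ie = i`, both having `a` as a left divisor. -/
theorem stmt14 {S : Type u} [Semigroup S] (n : ℕ) (hn : 2 ≤ n)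
    (hID : ∀ u ∈ SPow S (n - 1), ∀ y : S, u * y * u = u * y * u * y * u)
    (a b c : S) (ha : a ∈ SPow S (n - 1))
    (hne : a * b * a * c * a * b ≠ a * c * a * b * a * c * a * b) :
    (a * b * a * c * a * b) * (a * b * a * c * a * b) = a * b * a * c * a * b ∧
    (a * c * a * b * a * c * a * b) * (a * c * a * b * a * c * a * b)
      = a * c * a * b * a * c * a * b ∧
    a * b * a * c * a * b ≠ a * c * a * b * a * c * a * b ∧
    (a * b * a * c * a * b) * (a * c * a * b * a * c * a * b)
      = a * b * a * c * a * b ∧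
    (a * c * a * b * a * c * a * b) * (a * b * a * c * a * b)
      = a * c * a * b * a * c * a * b ∧
    a * b * a * c * a * b = a * (b * a * c * a * b) ∧
    a * c * a * b * a * c * a * b = a * (c * a * b * a * c * a * b) := by
  have h₁ : (a * b) * ((a * b) * (a * c)) = (a * b) * (a * c) := by
    simpa only [mul_assoc] using congrArg (· * c) (hID a ha b).symm
  have h₂ : (a * b) * ((a * c) * ((a * b) * ((a * c) * (a * b))))
      = (a * b) * ((a * c) * (a * b)) := by
    simpa only [mul_assoc] using congrArg (· * b) (hID a ha (b * a * c)).symm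
  obtain ⟨hee, hii, hei, hie⟩ := idempotent_pair_of_mul_eq h₁ h₂
  simp only [mul_assoc] at hee hii hei hie hne ⊢
  exact ⟨hee, hii, hne, hei, hie, trivial, trivial⟩
end

section
/- Let S be a finite semigroup with set of idempotents E, let Σ be an alphabet, and let φ: Σ⁺ → S be a semigroup homomorphism from the free semigroup on Σ. If a ∈ S does not belong to SES = {xey : x, y ∈ S, e ∈ E}, then every word w ∈ Σ⁺ with φ(w) = a has length at most |S| + 1. -/
universe u

/-- In a finite semigroup, an element with a right identity has an idempotent right identity. -/
theorem exists_idempotent_mul_right_eq {S : Type*} [Semigroup S] [Finite S] {p v : S}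
    (h : p * v = p) : ∃ e : S, p * e = p ∧ e * e = e := by
  let _ : TopologicalSpace S := ⊥
  have : DiscreteTopology S := ⟨rfl⟩
  exact exists_idempotent_in_compact_subsemigroup (fun _ => continuous_of_discreteTopology)
    {x | p * x = p} ⟨v, h⟩ (Set.toFinite _).isCompact fun x hx y hy => by
      simp only [Set.mem_ofPred_eq] at hx hy ⊢
      rw [← mul_assoc, hx, hy]

/-- if `φ : Σ⁺ → S` is a homomorphism into a finite semigroup
`S` and `a ∉ SES`, then every nonempty word mapping to `a` has length at most
`|S| + 1`. -/
theorem stmt15 {S α : Type u} [Semigroup S] [Fintype S]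
    (φ : List α → S) (hhom : IsSgHom φ)
    (a : S) (ha : a ∉ SES S) :
    ∀ w : List α, w ≠ [] → φ w = a → w.length ≤ Fintype.card S + 1 := by
  intro w _ hwa
  by_contra! hlen
  let f : Fin (Fintype.card S + 1) → S := fun i => φ (w.take (i + 1))
  obtain ⟨i, j, hij, hf⟩ : ∃ i j, i < j ∧ f i = f j := by
    obtain ⟨i, j, hne, hf⟩ := Fintype.exists_ne_map_eq_of_card_lt f (by simp)
    rcases lt_or_gt_of_ne hne with h | h
    exacts [⟨i, j, h, hf⟩, ⟨j, i, h, hf.symm⟩]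
  have hi := i.isLt
  have hj := j.isLt
  have hlt : (i : ℕ) < j := hij
  have hstable : f i * φ ((w.drop (i + 1)).take (j - i)) = f i := by
    conv_rhs => rw [hf]
    simp only [f]
    rw [← hhom _ _ (List.ne_nil_of_length_pos (by simp only [List.length_take]; omega))
      (List.ne_nil_of_length_pos (by simp only [List.length_take, List.length_drop]; omega)),
      ← List.take_add]
    congr 2
    omega
  obtain ⟨e, hpe, he⟩ := exists_idempotent_mul_right_eq hstable
  refine ha ⟨f i, e, φ (w.drop (i + 1)), he, ?_⟩
  rw [hpe, ← hwa, ← hhom _ _ (List.ne_nil_of_length_pos (by simp only [List.length_take]; omega))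
    (List.ne_nil_of_length_pos (by simp only [List.length_drop]; omega)), List.take_append_drop]
end
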